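/- arXiv:1506.08740 — 6 statements merged into one kernel-verified Lean document; each statement's English description precedes it below -/
import Mathlib

section
/- Assume the stationarity condition ι ∑_{i=1}^p w_i/ρ_i < 1. Then the polynomial P(X) = ∏_{i=1}^p (ρ_i − X) − ι ∑_{i=1}^p w_i ∏_{k ≠ i} (ρ_k − X) has exactly p real roots b_1 < b_2 < ⋯ < b_p, all simple, and these roots interlace with the ρ_i: 0 < b_1 < ρ_1 < b_2 < ρ_2 < ⋯ < b_p < ρ_p. -/
open Finset

section Secular

variable {α : Type*} [Fintype α] [DecidableEq α]

/-- The secular polynomial `∏ (ρᵢ − x) − ι ∑ wᵢ ∏_{k≠i} (ρₖ − x)`. -/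
def secular (ρ w : α → ℝ) (ι x : ℝ) : ℝ :=
  (∏ j, (ρ j - x)) - ι * ∑ j, w j * ∏ k ∈ univ.erase j, (ρ k - x)

lemma continuous_secular (ρ w : α → ℝ) (ι : ℝ) : Continuous (secular ρ w ι) := by
  unfold secular
  fun_prop

lemma secular_eq_prod_mul (ρ w : α → ℝ) (ι : ℝ) {x : ℝ} (hx : ∀ j, ρ j - x ≠ 0) :
    secular ρ w ι x = (∏ j, (ρ j - x)) * (1 - ι * ∑ j, w j / (ρ j - x)) := by
  have h : ∀ j, w j * ∏ k ∈ univ.erase j, (ρ k - x) = (∏ k, (ρ k - x)) * (w j / (ρ j - x)) := by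
    intro j
    rw [← mul_prod_erase univ (fun k => ρ k - x) (mem_univ j)]
    field_simp [hx j]
  rw [secular, sum_congr rfl fun j _ => h j, ← mul_sum]
  ring

lemma secular_at_pole (ρ w : α → ℝ) (ι : ℝ) (i : α) :
    secular ρ w ι (ρ i) = -(ι * (w i * ∏ k ∈ univ.erase i, (ρ k - ρ i))) := by
  rw [secular, prod_eq_zero (mem_univ i) (sub_self _), sum_eq_single i]
  · ring
  · intro j _ hj
    rw [prod_eq_zero (mem_erase.2 ⟨hj.symm, mem_univ i⟩) (sub_self _), mul_zero]
  · simp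

lemma secular_eq_zero_iff (ρ w : α → ℝ) (ι : ℝ) {x : ℝ} (hx : ∀ j, ρ j - x ≠ 0) :
    secular ρ w ι x = 0 ↔ 1 - ι * ∑ j, w j / (ρ j - x) = 0 := by
  rw [secular_eq_prod_mul ρ w ι hx, mul_eq_zero, or_iff_right (prod_ne_zero_iff.2 fun j _ => hx j)]

lemma secular_pole_ne_zero {ρ w : α → ℝ} {ι : ℝ} (hρ : Function.Injective ρ)
    (hw : ∀ i, 0 < w i) (hι : 0 < ι) (i : α) : secular ρ w ι (ρ i) ≠ 0 := by
  rw [secular_at_pole]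
  refine neg_ne_zero.2 (mul_ne_zero hι.ne' (mul_ne_zero (hw i).ne' (prod_ne_zero_iff.2 ?_)))
  intro k hk
  exact sub_ne_zero.2 (hρ.ne (ne_of_mem_erase hk))

/-- Two roots lying on the same side of every pole coincide. -/
lemma secular_root_unique [Nonempty α] {ρ w : α → ℝ} {ι : ℝ} (hw : ∀ i, 0 < w i) (hι : 0 < ι)
    {x y : ℝ} (hxy : ∀ j, 0 < (ρ j - x) * (ρ j - y))
    (hx : secular ρ w ι x = 0) (hy : secular ρ w ι y = 0) : x = y := by
  have hx0 : ∀ j, ρ j - x ≠ 0 := fun j => left_ne_zero_of_mul (hxy j).ne'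
  have hy0 : ∀ j, ρ j - y ≠ 0 := fun j => right_ne_zero_of_mul (hxy j).ne'
  rw [secular_eq_zero_iff ρ w ι hx0] at hx
  rw [secular_eq_zero_iff ρ w ι hy0] at hy
  have hdiff : ∑ j, w j / (ρ j - x) - ∑ j, w j / (ρ j - y)
      = (x - y) * ∑ j, w j / ((ρ j - x) * (ρ j - y)) := by
    rw [← sum_sub_distrib, mul_sum]
    refine sum_congr rfl fun j _ => ?_
    have := hx0 j
    have := hy0 j
    field_simp
    ring
  have hpos : 0 < ∑ j, w j / ((ρ j - x) * (ρ j - y)) :=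
    sum_pos (fun j _ => div_pos (hw j) (hxy j)) univ_nonempty
  have hzero : ι * ((x - y) * ∑ j, w j / ((ρ j - x) * (ρ j - y))) = 0 := by
    rw [← hdiff]
    linarith
  have := (mul_eq_zero.1 ((mul_eq_zero.1 hzero).resolve_left hι.ne')).resolve_right hpos.ne'
  linarith

lemma secular_ne_zero_of_forall_lt {ρ w : α → ℝ} {ι : ℝ} (hw : ∀ i, 0 < w i) (hι : 0 < ι)
    {x : ℝ} (hx : ∀ j, ρ j < x) : secular ρ w ι x ≠ 0 := by
  rw [Ne, secular_eq_zero_iff ρ w ι fun j => (sub_neg.2 (hx j)).ne]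
  have h : ∑ j, w j / (ρ j - x) ≤ 0 :=
    sum_nonpos fun j _ => (div_neg_of_pos_of_neg (hw j) (sub_neg.2 (hx j))).le
  have := mul_nonpos_of_nonneg_of_nonpos hι.le h
  linarith

lemma deriv_secular_ne_zero [Nonempty α] {ρ w : α → ℝ} {ι : ℝ} (hw : ∀ i, 0 < w i) (hι : 0 < ι)
    {x : ℝ} (hx : ∀ j, ρ j - x ≠ 0) (hroot : secular ρ w ι x = 0) :
    deriv (secular ρ w ι) x ≠ 0 := by
  have hev : secular ρ w ι =ᶠ[nhds x]
      fun y => (∏ j, (ρ j - y)) * (1 - ι * ∑ j, w j / (ρ j - y)) := by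
    have : ∀ᶠ y in nhds x, ∀ j, ρ j - y ≠ 0 :=
      Filter.eventually_all.2 fun j =>
        (by fun_prop : ContinuousAt (fun y => ρ j - y) x).eventually_ne (hx j)
    filter_upwards [this] with y hy using secular_eq_prod_mul ρ w ι hy
  have hprod : DifferentiableAt ℝ (fun y => ∏ j, (ρ j - y)) x := by fun_prop
  have hterm : ∀ j ∈ univ, HasDerivAt (fun y => w j / (ρ j - y)) (w j / (ρ j - x) ^ 2) x := by
    intro j _
    have h := (hasDerivAt_const x (w j)).fun_div ((hasDerivAt_id' x).const_sub (ρ j)) (hx j)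
    exact h.congr_deriv (by ring)
  have hsum := ((HasDerivAt.fun_sum hterm).const_mul ι).const_sub 1
  rw [hev.deriv_eq, (hprod.hasDerivAt.fun_mul hsum).deriv,
    (secular_eq_zero_iff ρ w ι hx).1 hroot, mul_zero, zero_add]
  have hpos : 0 < ∑ j, w j / (ρ j - x) ^ 2 :=
    sum_pos (fun j _ => div_pos (hw j) (sq_pos_of_ne_zero (hx j))) univ_nonempty
  exact mul_ne_zero (prod_ne_zero_iff.2 fun j _ => hx j) (neg_ne_zero.2 (mul_pos hι hpos).ne')

lemma secular_zero_pos {ρ w : α → ℝ} {ι : ℝ} (hρ : ∀ i, 0 < ρ i)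
    (hstat : ι * ∑ i, w i / ρ i < 1) : 0 < secular ρ w ι 0 := by
  rw [secular_eq_prod_mul ρ w ι fun j => by simpa using (hρ j).ne']
  simp only [sub_zero]
  exact mul_pos (prod_pos fun j _ => hρ j) (sub_pos.2 hstat)

lemma secular_pole_neg_of_forall_lt {ρ w : α → ℝ} {ι : ℝ} (hw : ∀ i, 0 < w i) (hι : 0 < ι)
    {i : α} (hi : ∀ k ≠ i, ρ i < ρ k) : secular ρ w ι (ρ i) < 0 := by
  rw [secular_at_pole]
  exact neg_neg_of_pos (mul_pos hι (mul_pos (hw i)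
    (prod_pos fun k hk => sub_pos.2 (hi k (ne_of_mem_erase hk)))))

/-- The secular polynomial has opposite signs at two consecutive poles. -/
lemma secular_pole_mul_neg {ρ w : α → ℝ} {ι : ℝ} (hw : ∀ i, 0 < w i) (hι : 0 < ι)
    {i j : α} (hij : ρ i < ρ j) (hadj : ∀ k, k ≠ i → k ≠ j → ρ k < ρ i ∨ ρ j < ρ k) :
    secular ρ w ι (ρ i) * secular ρ w ι (ρ j) < 0 := by
  have hne : i ≠ j := by
    rintro rfl
    exact hij.false
  have hpos : 0 < ∏ k ∈ (univ.erase i).erase j, (ρ k - ρ i) * (ρ k - ρ j) := by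
    refine prod_pos fun k hk => ?_
    obtain ⟨hkj, hki⟩ := mem_erase.1 hk
    rcases hadj k (ne_of_mem_erase hki) hkj with h | h
    · exact mul_pos_of_neg_of_neg (by linarith) (by linarith)
    · exact mul_pos (by linarith) (by linarith)
  rw [prod_mul_distrib] at hpos
  rw [secular_at_pole, secular_at_pole,
    ← mul_prod_erase (univ.erase i) _ (mem_erase.2 ⟨hne.symm, mem_univ j⟩),
    ← mul_prod_erase (univ.erase j) _ (mem_erase.2 ⟨hne, mem_univ i⟩),
    erase_right_comm (a := j) (b := i)]
  have := mul_pos (mul_pos (mul_pos hι hι) (mul_pos (hw i) (hw j)))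
    (mul_pos (mul_pos (sub_pos.2 hij) (sub_pos.2 hij)) hpos)
  linarith

end Secular

lemma exists_zero_of_mul_neg {f : ℝ → ℝ} (hf : Continuous f) {a b : ℝ} (hab : a < b)
    (h : f a * f b < 0) : ∃ c, a < c ∧ c < b ∧ f c = 0 := by
  rcases mul_neg_iff.1 h with ⟨ha, hb⟩ | ⟨ha, hb⟩
  · obtain ⟨c, hc, hc0⟩ := intermediate_value_Ioo' hab.le hf.continuousOn ⟨hb, ha⟩
    exact ⟨c, hc.1, hc.2, hc0⟩
  · obtain ⟨c, hc, hc0⟩ := intermediate_value_Ioo hab.le hf.continuousOn ⟨ha, hb⟩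
    exact ⟨c, hc.1, hc.2, hc0⟩

lemma exists_secular_root {p : ℕ} {ρ w : Fin p → ℝ} {ι : ℝ}
    (hρpos : ∀ i, 0 < ρ i) (hρmono : StrictMono ρ) (hw : ∀ i, 0 < w i) (hι : 0 < ι)
    (hstat : ι * ∑ i, w i / ρ i < 1) (i : Fin p) :
    ∃ c, 0 < c ∧ c < ρ i ∧ (∀ j < i, ρ j < c) ∧ secular ρ w ι c = 0 := by
  obtain ⟨n, hn⟩ := i
  cases n with
  | zero =>
    have hmin : ∀ k ≠ (⟨0, hn⟩ : Fin p), ρ ⟨0, hn⟩ < ρ k := fun k hk =>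
      hρmono (Fin.lt_def.2 (Nat.pos_of_ne_zero fun h => hk (Fin.ext h)))
    obtain ⟨c, h0, h1, hc⟩ := exists_zero_of_mul_neg (continuous_secular ρ w ι) (hρpos ⟨0, hn⟩)
      (mul_neg_of_pos_of_neg (secular_zero_pos hρpos hstat)
        (secular_pole_neg_of_forall_lt hw hι hmin))
    exact ⟨c, h0, h1, fun j hj => absurd (Fin.lt_def.1 hj) (Nat.not_lt_zero _), hc⟩
  | succ n =>
    let l : Fin p := ⟨n, by omega⟩
    have hlt : ρ l < ρ ⟨n + 1, hn⟩ := hρmono (Fin.lt_def.2 n.lt_succ_self)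
    have hadj : ∀ k, k ≠ l → k ≠ ⟨n + 1, hn⟩ → ρ k < ρ l ∨ ρ ⟨n + 1, hn⟩ < ρ k := by
      intro k hk hk'
      simp only [hρmono.lt_iff_lt, Fin.lt_def, Ne, Fin.ext_iff, l] at hk hk' ⊢
      omega
    obtain ⟨c, h0, h1, hc⟩ := exists_zero_of_mul_neg (continuous_secular ρ w ι) hlt
      (secular_pole_mul_neg hw hι hlt hadj)
    refine ⟨c, (hρpos l).trans h0, h1, fun j hj => lt_of_le_of_lt (hρmono.monotone ?_) h0, hc⟩
    exact Fin.le_def.2 (Nat.lt_succ_iff.1 (Fin.lt_def.1 hj))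

/-- Under the stationarity condition `ι ∑ wᵢ/ρᵢ < 1`, the polynomial
`P(X) = ∏ (ρᵢ − X) − ι ∑ wᵢ ∏_{k≠i} (ρₖ − X)` has exactly `p` real roots
`b₁ < ⋯ < b_p`, all simple, interlacing the `ρᵢ`:
`0 < b₁ < ρ₁ < b₂ < ρ₂ < ⋯ < b_p < ρ_p`. -/
theorem stmt0 (p : ℕ) (hp : 0 < p) (ρ w : Fin p → ℝ) (ι : ℝ)
    (hρpos : ∀ i, 0 < ρ i) (hρmono : StrictMono ρ)
    (hw : ∀ i, 0 < w i) (hι : 0 < ι)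
    (hstat : ι * ∑ i, w i / ρ i < 1) :
    ∃ b : Fin p → ℝ, StrictMono b ∧
      (∀ i, 0 < b i) ∧
      (∀ i, b i < ρ i) ∧
      (∀ i : Fin p, ∀ h : (i : ℕ) + 1 < p, ρ i < b ⟨(i : ℕ) + 1, h⟩) ∧
      (∀ x : ℝ,
        ((∏ i, (ρ i - x)) - ι * ∑ i, w i * ∏ k ∈ univ.erase i, (ρ k - x) = 0)
          ↔ ∃ i, x = b i) ∧
      (∀ i, deriv
          (fun x => (∏ j, (ρ j - x)) - ι * ∑ j, w j * ∏ k ∈ univ.erase j, (ρ k - x))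
          (b i) ≠ 0) := by
  have : Nonempty (Fin p) := ⟨⟨0, hp⟩⟩
  choose b hb0 hbρ hρb hroot using exists_secular_root hρpos hρmono hw hι hstat
  have hne : ∀ i j, ρ j - b i ≠ 0 := fun i j h =>
    secular_pole_ne_zero hρmono.injective hw hι j (by rw [sub_eq_zero.1 h]; exact hroot i)
  refine ⟨b, fun i j hij => (hbρ i).trans (hρb j i hij), hb0, hbρ,
    fun i h => hρb _ i (Fin.lt_def.2 (Nat.lt_succ_self _)), fun x => ⟨fun hx => ?_, ?_⟩,
    fun i => deriv_secular_ne_zero hw hι (hne i) (hroot i)⟩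
  · change secular ρ w ι x = 0 at hx
    have hxρ : ∀ j, ρ j ≠ x := by
      rintro j rfl
      exact secular_pole_ne_zero hρmono.injective hw hι j hx
    have hex : ∃ i, x < ρ i := by
      by_contra! h
      exact secular_ne_zero_of_forall_lt hw hι (fun j => (h j).lt_of_ne (hxρ j)) hx
    obtain ⟨i, hi, hmin⟩ := WellFounded.has_min (wellFounded_lt (α := Fin p)) {i | x < ρ i} hex
    refine ⟨i, secular_root_unique hw hι (fun j => ?_) hx (hroot i)⟩
    rcases lt_or_ge j i with hj | hj
    · have hjx : ρ j < x := (not_lt.1 fun h => hmin j h hj).lt_of_ne (hxρ j)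
      exact mul_pos_of_neg_of_neg (sub_neg.2 hjx) (sub_neg.2 (hρb i j hj))
    · have hij := hρmono.monotone hj
      exact mul_pos (sub_pos.2 (lt_of_lt_of_le hi hij)) (sub_pos.2 ((hbρ i).trans_le hij))
  · rintro ⟨i, rfl⟩
    exact hroot i
end

section
/- Let p ≥ 1 and let real numbers satisfy the interlacing property 0 < b_1 < ρ_1 < b_2 < ρ_2 < ⋯ < b_p < ρ_p. Then the p×p Cauchy-type matrix B with entries B_{i,j} = 1/(ρ_i² − b_j²) is invertible, and every entry of the vector v = B⁻¹ · (1, …, 1)ᵀ is strictly positive. -/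
open Matrix

/-- A square Cauchy matrix with distinct nodes is invertible. -/
theorem isUnit_cauchyMatrix {ι K : Type*} [Fintype ι] [DecidableEq ι] [Field K] {x y : ι → K}
    (hx : Function.Injective x) (hy : Function.Injective y) (hxy : ∀ i j, x i ≠ y j) :
    IsUnit (Matrix.of fun i j => 1 / (x i - y j)) := by
  refine Matrix.mulVec_injective_iff_isUnit.1
    ((injective_iff_map_eq_zero (Matrix.mulVecLin _)).2 fun c hc => ?_)
  set r : ι → K := fun j => c j * ∏ k ∈ Finset.univ.erase j, (y j - y k) with hr
  have hprod (j : ι) : ∏ k ∈ Finset.univ.erase j, (y j - y k) ≠ 0 :=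
    Finset.prod_ne_zero_iff.2 fun k hk =>
      sub_ne_zero.2 (hy.ne (Finset.ne_of_mem_erase hk).symm)
  have hP : Lagrange.interpolate Finset.univ y r = 0 := by
    refine Polynomial.eq_zero_of_degree_lt_of_eval_index_eq_zero (s := Finset.univ) (v := x) hx.injOn
      (Lagrange.degree_interpolate_lt _ hy.injOn) fun i _ => ?_
    rw [Lagrange.eval_interpolate_not_at_node _ fun j _ => hxy i j]
    refine mul_eq_zero_of_right _ (Eq.trans (Finset.sum_congr rfl fun j _ => ?_) (congrFun hc i))
    have := hprod j
    simp only [Lagrange.nodalWeight, Finset.prod_inv_distrib, hr, Matrix.of_apply]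
    field_simp
  funext j
  have h := Lagrange.eval_interpolate_at_node r hy.injOn (Finset.mem_univ j)
  rw [hP, Polynomial.eval_zero] at h
  exact (mul_eq_zero.1 h.symm).resolve_right (hprod j)

/-- The explicit solution of the Cauchy system with constant right-hand side `1`. -/
theorem cauchyMatrix_mulVec_eq_one {ι K : Type*} [Fintype ι] [DecidableEq ι] [Field K]
    {x y : ι → K} (hy : Function.Injective y) (hxy : ∀ i j, x i ≠ y j) :
    (Matrix.of fun i j => 1 / (x i - y j)) *ᵥ
      (fun j => (x j - y j) * ∏ k ∈ Finset.univ.erase j, (y j - x k) / (y j - y k)) =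
      fun _ => 1 := by
  funext i
  have hcard : (Finset.univ.erase i).card + 1 = (Finset.univ : Finset ι).card :=
    Finset.card_erase_add_one (Finset.mem_univ i)
  have hmonic := Polynomial.monic_prod_X_sub_C x (Finset.univ.erase i)
  have h := Lagrange.leadingCoeff_eq_sum (s := Finset.univ) (v := y) hy.injOn
    (P := ∏ k ∈ Finset.univ.erase i, (Polynomial.X - Polynomial.C (x k))) (by
      rw [Polynomial.degree_eq_natDegree hmonic.ne_zero,
        Polynomial.natDegree_finsetProd_X_sub_C_eq_card, ← hcard]
      norm_cast)
  rw [hmonic.leadingCoeff] at h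
  refine Eq.trans (Finset.sum_congr rfl fun j _ => ?_) h.symm
  have hi := Finset.mul_prod_erase Finset.univ (fun k => y j - x k) (Finset.mem_univ i)
  have hj := Finset.mul_prod_erase Finset.univ (fun k => y j - x k) (Finset.mem_univ j)
  have hne : x i - y j ≠ 0 := sub_ne_zero.2 (hxy i j)
  have key : (x j - y j) * ∏ k ∈ Finset.univ.erase j, (y j - x k) =
      (x i - y j) * ∏ k ∈ Finset.univ.erase i, (y j - x k) := by
    linear_combination hi - hj
  simp only [Matrix.of_apply, Finset.prod_div_distrib, Polynomial.eval_prod, Polynomial.eval_sub,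
    Polynomial.eval_X, Polynomial.eval_C]
  rw [← mul_div_assoc, key]
  field_simp

/-- The Cauchy-type matrix of interlacing nodes `y₀ < x₀ < y₁ < x₁ < ⋯` is invertible and maps
a strictly positive vector to the constant vector `1`. -/
theorem cauchyMatrix_inv_mulVec_one_pos {ι K : Type*} [Fintype ι] [LinearOrder ι] [Field K]
    [LinearOrder K] [IsStrictOrderedRing K] {x y : ι → K} (hyx : ∀ i, y i < x i)
    (hlt : ∀ i j, i < j → x i < y j) :
    IsUnit (Matrix.of fun i j => 1 / (x i - y j)) ∧
      ∀ i, 0 < ((Matrix.of fun i j => 1 / (x i - y j))⁻¹ *ᵥ fun _ => (1 : K)) i := by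
  have hx : StrictMono x := fun i j h => (hlt i j h).trans (hyx j)
  have hy : StrictMono y := fun i j h => (hyx i).trans (hlt i j h)
  have hxy (i j : ι) : x i ≠ y j := by
    rcases lt_or_ge i j with h | h
    · exact (hlt i j h).ne
    · exact ((hy.monotone h).trans_lt (hyx i)).ne'
  have hB := isUnit_cauchyMatrix hx.injective hy.injective hxy
  refine ⟨hB, fun j => ?_⟩
  rw [← cauchyMatrix_mulVec_eq_one hy.injective hxy, Matrix.mulVec_mulVec,
    Matrix.nonsing_inv_mul _ ((Matrix.isUnit_iff_isUnit_det _).1 hB), Matrix.one_mulVec]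
  refine mul_pos (sub_pos.2 (hyx j)) (Finset.prod_pos fun k hk => ?_)
  rcases (Finset.ne_of_mem_erase hk).lt_or_gt with h | h
  · exact div_pos (sub_pos.2 (hlt k j h)) (sub_pos.2 (hy h))
  · exact div_pos_of_neg_of_neg (sub_neg.2 ((hy h).trans (hyx k))) (sub_neg.2 (hy h))

/-- Under the interlacing property `0 < b₁ < ρ₁ < b₂ < ρ₂ < ⋯ < b_p < ρ_p`,
the Cauchy-type matrix `B_{i,j} = 1/(ρᵢ² − bⱼ²)` is invertible and every entry of
`B⁻¹ · (1,…,1)ᵀ` is strictly positive. -/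
theorem stmt3 (p : ℕ) (hp : 0 < p) (b ρ : Fin p → ℝ)
    (h1 : ∀ i, 0 < b i) (h2 : ∀ i, b i < ρ i)
    (h3 : ∀ i : Fin p, ∀ h : (i : ℕ) + 1 < p, ρ i < b ⟨(i : ℕ) + 1, h⟩)
    (B : Matrix (Fin p) (Fin p) ℝ)
    (hB : B = Matrix.of fun i j => 1 / (ρ i ^ 2 - b j ^ 2)) :
    IsUnit B ∧ ∀ i, 0 < (B⁻¹ *ᵥ fun _ => (1 : ℝ)) i := by
  have hlt (i : Fin p) (n : ℕ) : ∀ hn : n < p, (i : ℕ) + 1 ≤ n → ρ i < b ⟨n, hn⟩ := by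
    intro hn hin
    induction n, hin using Nat.le_induction with
    | base => exact h3 i hn
    | succ n _ ih =>
      have hn' : n < p := (Nat.lt_succ_self n).trans hn
      exact ((ih hn').trans (h2 _)).trans (h3 ⟨n, hn'⟩ hn)
  subst hB
  refine cauchyMatrix_inv_mulVec_one_pos (x := fun i => ρ i ^ 2) (y := fun j => b j ^ 2)
    (fun i => pow_lt_pow_left₀ (h2 i) (h1 i).le two_ne_zero) fun i j hij => ?_
  exact pow_lt_pow_left₀ (hlt i j j.isLt hij) ((h1 i).trans (h2 i)).le two_ne_zero
end

section
/- Let p ≥ 1, 0 < ρ_1 < ⋯ < ρ_p, w_1, …, w_p > 0, ι > 0, κ̄ > 0, and let b_1, …, b_p > 0 and a_1, …, a_p ∈ ℝ be such that b_j ≠ ρ_i for all i, j. Assume the algebraic conditions: (i) for every j ∈ {1,…,p}, ι ∑_{i=1}^p w_i/(ρ_i − b_j) = 1, and (ii) for every i ∈ {1,…,p}, ∑_{j=1}^p a_j b_j/(ρ_i² − b_j²) = κ̄. Then the even function c(u) = ∑_{j=1}^p a_j e^{−b_j |u|} satisfies the Hawkes autocovariance consistency equation: c(τ) = 2 κ̄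 ι K(τ) + ι ∫_{−∞}^τ K(τ−u) c(u) du for all τ > 0. -/
open MeasureTheory

theorem integrableOn_Iic_exp_mul_exp_abs {r b τ : ℝ} (hr : 0 < r) (hb : 0 < b) (hτ : 0 < τ) :
    IntegrableOn (fun u => Real.exp (-r * (τ - u)) * Real.exp (-b * |u|)) (Set.Iic τ) := by
  rw [← Set.Iic_union_Ioc_eq_Iic hτ.le]
  refine IntegrableOn.union ?_ ?_
  · refine IntegrableOn.congr_fun
      ((integrableOn_exp_mul_Iic (add_pos hr hb) 0).const_mul (Real.exp (-r * τ)))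
      (fun u hu => ?_) measurableSet_Iic
    simp only [abs_of_nonpos (Set.mem_Iic.1 hu), ← Real.exp_add]
    ring_nf
  · exact (Continuous.integrableOn_Icc (by fun_prop)).mono_set Set.Ioc_subset_Icc_self

theorem integral_Iic_exp_mul_exp_abs {r b τ : ℝ} (hr : 0 < r) (hb : 0 < b) (hne : b ≠ r)
    (hτ : 0 < τ) :
    ∫ u in Set.Iic τ, Real.exp (-r * (τ - u)) * Real.exp (-b * |u|) =
      Real.exp (-b * τ) / (r - b) - 2 * b / (r ^ 2 - b ^ 2) * Real.exp (-r * τ) := by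
  have hint := integrableOn_Iic_exp_mul_exp_abs hr hb hτ
  rw [← Set.Iic_union_Ioc_eq_Iic hτ.le] at hint ⊢
  have hsub : r - b ≠ 0 := sub_ne_zero.2 hne.symm
  have hadd : r + b ≠ 0 := (add_pos hr hb).ne'
  rw [setIntegral_union (Set.Iic_disjoint_Ioc le_rfl) measurableSet_Ioc
    hint.left_of_union hint.right_of_union]
  have hneg : ∫ u in Set.Iic (0 : ℝ), Real.exp (-r * (τ - u)) * Real.exp (-b * |u|) =
      Real.exp (-r * τ) / (r + b) := by
    rw [setIntegral_congr_fun (g := fun u => Real.exp (-r * τ) * Real.exp ((r + b) * u))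
      measurableSet_Iic, integral_const_mul, integral_exp_mul_Iic (add_pos hr hb)]
    · simp [div_eq_mul_inv]
    · intro u hu
      simp only [abs_of_nonpos (Set.mem_Iic.1 hu), ← Real.exp_add]
      ring_nf
  have hpos : ∫ u in Set.Ioc 0 τ, Real.exp (-r * (τ - u)) * Real.exp (-b * |u|) =
      (Real.exp (-b * τ) - Real.exp (-r * τ)) / (r - b) := by
    rw [setIntegral_congr_fun (g := fun u => Real.exp (-r * τ) * Real.exp ((r - b) * u))
      measurableSet_Ioc, integral_const_mul, ← intervalIntegral.integral_of_le hτ.le,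
      intervalIntegral.integral_comp_mul_left (fun x => Real.exp x) hsub, integral_exp]
    · rw [smul_eq_mul, mul_left_comm, mul_sub, ← Real.exp_add, mul_zero, Real.exp_zero, mul_one,
        div_eq_inv_mul]
      ring_nf
    · intro u hu
      simp only [abs_of_pos (Set.mem_Ioc.1 hu).1, ← Real.exp_add]
      ring_nf
  rw [hneg, hpos, sq_sub_sq]
  field_simp
  ring

/-- Under the algebraic conditions (i) `ι ∑ᵢ wᵢ/(ρᵢ − bⱼ) = 1` for all `j`
and (ii) `∑ⱼ aⱼbⱼ/(ρᵢ² − bⱼ²) = κ̄` for all `i`, the even function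
`c(u) = ∑ⱼ aⱼ e^{−bⱼ|u|}` satisfies the Hawkes autocovariance consistency equation
`c(τ) = 2κ̄ι K(τ) + ι ∫_{−∞}^τ K(τ−u) c(u) du` for all `τ > 0`. -/
theorem stmt6 (p : ℕ) (hp : 0 < p) (ρ w b a : Fin p → ℝ) (ι κ : ℝ)
    (hρpos : ∀ i, 0 < ρ i) (hρmono : StrictMono ρ)
    (hw : ∀ i, 0 < w i) (hι : 0 < ι) (hκ : 0 < κ)
    (hb : ∀ j, 0 < b j) (hne : ∀ i j, b j ≠ ρ i)
    (hi : ∀ j, ι * ∑ i, w i / (ρ i - b j) = 1)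
    (hii : ∀ i, ∑ j, a j * b j / (ρ i ^ 2 - b j ^ 2) = κ) :
    ∀ τ : ℝ, 0 < τ →
      (∑ j, a j * Real.exp (-b j * |τ|))
        = 2 * κ * ι * (∑ i, w i * Real.exp (-ρ i * τ))
          + ι * ∫ u in Set.Iic τ,
              (∑ i, w i * Real.exp (-ρ i * (τ - u))) * (∑ j, a j * Real.exp (-b j * |u|)) := by
  intro τ hτ
  have hint : ∫ u in Set.Iic τ,
      (∑ i, w i * Real.exp (-ρ i * (τ - u))) * (∑ j, a j * Real.exp (-b j * |u|)) =
      ∑ i, ∑ j, w i * a j * (Real.exp (-b j * τ) / (ρ i - b j) -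
        2 * b j / (ρ i ^ 2 - b j ^ 2) * Real.exp (-ρ i * τ)) := by
    have hI : ∀ i j, IntegrableOn (fun u => w i * a j *
        (Real.exp (-ρ i * (τ - u)) * Real.exp (-b j * |u|))) (Set.Iic τ) := fun i j =>
      (integrableOn_Iic_exp_mul_exp_abs (hρpos i) (hb j) hτ).const_mul _
    simp_rw [Finset.sum_mul_sum, mul_mul_mul_comm]
    rw [integral_finsetSum _ fun i _ => integrable_finsetSum _ fun j _ => hI i j]
    refine Finset.sum_congr rfl fun i _ => ?_
    rw [integral_finsetSum _ fun j _ => hI i j]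
    refine Finset.sum_congr rfl fun j _ => ?_
    rw [integral_const_mul, integral_Iic_exp_mul_exp_abs (hρpos i) (hb j) (hne i j) hτ]
  have hfirst : ι * ∑ i, ∑ j, w i * a j * (Real.exp (-b j * τ) / (ρ i - b j)) =
      ∑ j, a j * Real.exp (-b j * τ) := by
    rw [Finset.sum_comm, Finset.mul_sum]
    refine Finset.sum_congr rfl fun j _ => ?_
    rw [← mul_one (a j * _), ← hi j, mul_left_comm, Finset.mul_sum _ _ (a j * _)]
    congr 1
    refine Finset.sum_congr rfl fun i _ => ?_
    ring
  have hsecond : ∑ i, ∑ j, w i * a j * (2 * b j / (ρ i ^ 2 - b j ^ 2) * Real.exp (-ρ i * τ)) =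
      2 * κ * ∑ i, w i * Real.exp (-ρ i * τ) := by
    rw [Finset.mul_sum]
    refine Finset.sum_congr rfl fun i _ => ?_
    rw [← hii i, Finset.mul_sum, Finset.sum_mul]
    refine Finset.sum_congr rfl fun j _ => ?_
    ring
  rw [hint, abs_of_pos hτ]
  simp only [mul_sub (w _ * a _), Finset.sum_sub_distrib]
  rw [mul_sub, hfirst, hsecond]
  ring
end

section
/- Let ρ > ι > 0 and κ_∞ > 0, and set κ̄ = κ_∞/(1 − ι/ρ). Then the even function c(τ) = (ι(2ρ − ι)/(2ρ)) · (2κ_∞/(1 − ι/ρ)²) · e^{−(ρ−ι)|τ|} satisfies c(τ) = 2 κ̄ ι e^{−ρτ} + ι ∫_{−∞}^τ e^{−ρ(τ−u)} c(u) du for all τ > 0. -/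
open MeasureTheory

/-- The convolution of `e^{-ρ t}` on the half-line with the symmetric exponential `e^{-(ρ-ι)|u|}`. -/
theorem integral_Iic_exp_mul_exp_abs_s7 {ρ ι τ : ℝ} (hι : 0 < ι) (hρι : ι < ρ) (hτ : 0 < τ) :
    ∫ u in Set.Iic τ, Real.exp (-ρ * (τ - u)) * Real.exp (-(ρ - ι) * |u|)
      = Real.exp (-ρ * τ) * (1 / (2 * ρ - ι) + (Real.exp (ι * τ) - 1) / ι) := by
  have hneg : Set.EqOn (fun u => Real.exp (-ρ * (τ - u)) * Real.exp (-(ρ - ι) * |u|))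
      (fun u => Real.exp (-ρ * τ) * Real.exp ((2 * ρ - ι) * u)) (Set.Iic 0) := by
    intro u hu
    simp only [abs_of_nonpos (Set.mem_Iic.mp hu), ← Real.exp_add]
    ring_nf
  have hpos : Set.EqOn (fun u => Real.exp (-ρ * (τ - u)) * Real.exp (-(ρ - ι) * |u|))
      (fun u => Real.exp (-ρ * τ) * Real.exp (ι * u)) (Set.uIcc 0 τ) := by
    intro u hu
    rw [Set.uIcc_of_le hτ.le] at hu
    simp only [abs_of_nonneg hu.1, ← Real.exp_add]
    ring_nf
  have hint0 : IntegrableOn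
      (fun u => Real.exp (-ρ * (τ - u)) * Real.exp (-(ρ - ι) * |u|)) (Set.Iic 0) :=
    IntegrableOn.congr_fun ((integrableOn_exp_mul_Iic (by linarith) 0).const_mul _) hneg.symm
      measurableSet_Iic
  have hint : IntegrableOn
      (fun u => Real.exp (-ρ * (τ - u)) * Real.exp (-(ρ - ι) * |u|)) (Set.Iic τ) := by
    rw [← Set.Iic_union_Ioc_eq_Iic hτ.le]
    exact hint0.union (Continuous.integrableOn_Ioc (by fun_prop))
  have hsplit := intervalIntegral.integral_Iic_sub_Iic hint0 hint
  rw [intervalIntegral.integral_congr hpos, setIntegral_congr_fun measurableSet_Iic hneg,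
    integral_const_mul, intervalIntegral.integral_const_mul, integral_exp_mul_Iic (by linarith),
    intervalIntegral.integral_comp_mul_left (fun x => Real.exp x) hι.ne', integral_exp] at hsplit
  simp only [mul_zero, Real.exp_zero, smul_eq_mul] at hsplit
  rw [sub_eq_iff_eq_add.mp hsplit]
  ring

/-- For `ρ > ι > 0`, `κ_∞ > 0` and `κ̄ = κ_∞/(1 − ι/ρ)`, the even function
`c(τ) = (ι(2ρ−ι)/(2ρ)) (2κ_∞/(1−ι/ρ)²) e^{−(ρ−ι)|τ|}` satisfies
`c(τ) = 2κ̄ι e^{−ρτ} + ι ∫_{−∞}^τ e^{−ρ(τ−u)} c(u) du` for all `τ > 0`. -/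
theorem stmt7 (ρ ι κinf : ℝ) (hι : 0 < ι) (hρι : ι < ρ) (hκ : 0 < κinf)
    (c : ℝ → ℝ)
    (hc : c = fun τ =>
      (ι * (2 * ρ - ι) / (2 * ρ)) * (2 * κinf / (1 - ι / ρ) ^ 2)
        * Real.exp (-(ρ - ι) * |τ|)) :
    ∀ τ : ℝ, 0 < τ →
      c τ = 2 * (κinf / (1 - ι / ρ)) * ι * Real.exp (-ρ * τ)
        + ι * ∫ u in Set.Iic τ, Real.exp (-ρ * (τ - u)) * c u := by
  intro τ hτ
  have hρ : ρ ≠ 0 := by linarith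
  have hsub : ρ - ι ≠ 0 := by linarith
  have hden : 2 * ρ - ι ≠ 0 := by linarith
  have hone : 1 - ι / ρ = (ρ - ι) / ρ := by field_simp
  have hexp : Real.exp (-(ρ - ι) * τ) = Real.exp (-ρ * τ) * Real.exp (ι * τ) := by
    rw [← Real.exp_add]
    ring_nf
  subst hc
  simp only [mul_left_comm (Real.exp (-ρ * (τ - _)))]
  rw [integral_const_mul, integral_Iic_exp_mul_exp_abs_s7 hι hρι hτ, abs_of_pos hτ, hexp, hone]
  field_simp
  ring
end

section
/- Assume the stationarity condition ι ∑_{i=1}^p w_i/ρ_i < 1. If c₁ and c₂ are two bounded measurable even functions from ℝ to ℝ each satisfying the Hawkes autocovariance consistency equation, then c₁(τ) = c₂(τ) for every τ > 0. -/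
open MeasureTheory

lemma exp_neg_mul_sub (r t u : ℝ) :
    Real.exp (-r * (t - u)) = Real.exp (-r * t) * Real.exp (r * u) := by
  rw [← Real.exp_add]
  ring_nf

lemma integrableOn_exp_neg_mul_sub_Iic {r : ℝ} (hr : 0 < r) (t : ℝ) :
    IntegrableOn (fun u => Real.exp (-r * (t - u))) (Set.Iic t) := by
  simp only [exp_neg_mul_sub]
  exact (integrableOn_exp_mul_Iic hr t).const_mul _

lemma integral_exp_neg_mul_sub_Iic {r : ℝ} (hr : 0 < r) (t : ℝ) :
    ∫ u in Set.Iic t, Real.exp (-r * (t - u)) = 1 / r := by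
  simp only [exp_neg_mul_sub]
  rw [integral_const_mul, integral_exp_mul_Iic hr, ← mul_div_assoc, ← Real.exp_add]
  simp

lemma integrableOn_sum_exp_Iic {p : ℕ} {ρ : Fin p → ℝ} (w : Fin p → ℝ)
    (hρ : ∀ i, 0 < ρ i) (t : ℝ) :
    IntegrableOn (fun u => ∑ i, w i * Real.exp (-ρ i * (t - u))) (Set.Iic t) :=
  integrable_finsetSum _ fun i _ => (integrableOn_exp_neg_mul_sub_Iic (hρ i) t).const_mul _

lemma integral_sum_exp_Iic {p : ℕ} {ρ : Fin p → ℝ} (w : Fin p → ℝ)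
    (hρ : ∀ i, 0 < ρ i) (t : ℝ) :
    ∫ u in Set.Iic t, ∑ i, w i * Real.exp (-ρ i * (t - u)) = ∑ i, w i / ρ i := by
  rw [integral_finsetSum _ fun i _ => (integrableOn_exp_neg_mul_sub_Iic (hρ i) t).const_mul _]
  refine Finset.sum_congr rfl fun i _ => ?_
  rw [integral_const_mul, integral_exp_neg_mul_sub_Iic (hρ i), mul_one_div]

lemma integrableOn_sum_exp_mul_Iic {p : ℕ} {ρ : Fin p → ℝ} (w : Fin p → ℝ)
    (hρ : ∀ i, 0 < ρ i) {c : ℝ → ℝ} (hc : Measurable c) (hbd : ∃ C, ∀ x, |c x| ≤ C) (t : ℝ) :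
    IntegrableOn (fun u => (∑ i, w i * Real.exp (-ρ i * (t - u))) * c u) (Set.Iic t) := by
  obtain ⟨C, hC⟩ := hbd
  exact (integrableOn_sum_exp_Iic w hρ t).mul_bdd (c := C) hc.aestronglyMeasurable
    (Filter.Eventually.of_forall hC)

/-- An even function bounded by `B` on the positive reals has its convolution with a nonnegative
exponential-sum kernel bounded by `B` times the mass of the kernel. -/
lemma abs_integral_sum_exp_mul_Iic_le {p : ℕ} {ρ w : Fin p → ℝ} (hρ : ∀ i, 0 < ρ i)
    (hw : ∀ i, 0 < w i) {d : ℝ → ℝ} (heven : ∀ x, d (-x) = d x) {B : ℝ}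
    (hB : ∀ x, 0 < x → |d x| ≤ B) (t : ℝ) :
    |∫ u in Set.Iic t, (∑ i, w i * Real.exp (-ρ i * (t - u))) * d u|
      ≤ (∑ i, w i / ρ i) * B := by
  rw [← integral_sum_exp_Iic w hρ t, ← integral_mul_const, ← Real.norm_eq_abs]
  refine norm_integral_le_of_norm_le ((integrableOn_sum_exp_Iic w hρ t).mul_const B) ?_
  have hne : ∀ᵐ u ∂(volume.restrict (Set.Iic t)), u ≠ (0 : ℝ) :=
    ae_restrict_of_ae (Measure.ae_ne volume 0)
  filter_upwards [hne] with u hu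
  have hK : 0 ≤ ∑ i, w i * Real.exp (-ρ i * (t - u)) :=
    Finset.sum_nonneg fun i _ => mul_nonneg (hw i).le (Real.exp_pos _).le
  rw [norm_mul, Real.norm_of_nonneg hK, Real.norm_eq_abs]
  refine mul_le_mul_of_nonneg_left ?_ hK
  rcases hu.lt_or_gt with h | h
  · rw [← heven]
    exact hB _ (neg_pos.mpr h)
  · exact hB u h

/-- Under the stationarity condition `ι ∑ᵢ wᵢ/ρᵢ < 1`, two bounded measurable
even functions `c₁, c₂ : ℝ → ℝ` satisfying the Hawkes autocovariance consistency equation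
`c(τ) = 2κ̄ι K(τ) + ι ∫_{−∞}^τ K(τ−u) c(u) du` for all `τ > 0` agree on `(0,∞)`. -/
theorem stmt8 (p : ℕ) (hp : 0 < p) (ρ w : Fin p → ℝ) (ι κ : ℝ)
    (hρpos : ∀ i, 0 < ρ i) (hρmono : StrictMono ρ)
    (hw : ∀ i, 0 < w i) (hι : 0 < ι) (hκ : 0 < κ)
    (hstat : ι * ∑ i, w i / ρ i < 1)
    (c₁ c₂ : ℝ → ℝ)
    (hmeas₁ : Measurable c₁) (hmeas₂ : Measurable c₂)
    (hbd₁ : ∃ C, ∀ x, |c₁ x| ≤ C) (hbd₂ : ∃ C, ∀ x, |c₂ x| ≤ C)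
    (heven₁ : ∀ x, c₁ (-x) = c₁ x) (heven₂ : ∀ x, c₂ (-x) = c₂ x)
    (heq₁ : ∀ τ : ℝ, 0 < τ →
      c₁ τ = 2 * κ * ι * (∑ i, w i * Real.exp (-ρ i * τ))
        + ι * ∫ u in Set.Iic τ, (∑ i, w i * Real.exp (-ρ i * (τ - u))) * c₁ u)
    (heq₂ : ∀ τ : ℝ, 0 < τ →
      c₂ τ = 2 * κ * ι * (∑ i, w i * Real.exp (-ρ i * τ))
        + ι * ∫ u in Set.Iic τ, (∑ i, w i * Real.exp (-ρ i * (τ - u))) * c₂ u) :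
    ∀ τ : ℝ, 0 < τ → c₁ τ = c₂ τ := by
  obtain ⟨C₁, hC₁⟩ := hbd₁
  obtain ⟨C₂, hC₂⟩ := hbd₂
  set d : ℝ → ℝ := fun x => c₁ x - c₂ x with hd
  have hdeven : ∀ x, d (-x) = d x := fun x => by simp only [hd, heven₁, heven₂]
  have hdeq : ∀ τ : ℝ, 0 < τ →
      d τ = ι * ∫ u in Set.Iic τ, (∑ i, w i * Real.exp (-ρ i * (τ - u))) * d u := by
    intro τ hτ
    simp only [hd, mul_sub]
    rw [integral_sub, heq₁ τ hτ, heq₂ τ hτ]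
    · simp only [mul_sub]
      ring
    · simpa only [IntegrableOn, mul_sub] using
        integrableOn_sum_exp_mul_Iic w hρpos hmeas₁ ⟨C₁, hC₁⟩ τ
    · simpa only [IntegrableOn, mul_sub] using
        integrableOn_sum_exp_mul_Iic w hρpos hmeas₂ ⟨C₂, hC₂⟩ τ
  set A : Set ℝ := (fun x => |d x|) '' Set.Ioi 0
  have hbdd : BddAbove A := by
    refine ⟨C₁ + C₂, ?_⟩
    rintro _ ⟨x, -, rfl⟩
    exact (abs_sub _ _).trans (add_le_add (hC₁ x) (hC₂ x))
  have hle : ∀ x, 0 < x → |d x| ≤ sSup A := fun x hx => le_csSup hbdd ⟨x, hx, rfl⟩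
  have hcontr : sSup A ≤ ι * (∑ i, w i / ρ i) * sSup A := by
    refine csSup_le ⟨_, 1, Set.mem_Ioi.mpr one_pos, rfl⟩ ?_
    rintro _ ⟨x, hx, rfl⟩
    simp only
    rw [hdeq x hx, abs_mul, abs_of_pos hι, mul_assoc]
    exact mul_le_mul_of_nonneg_left
      (abs_integral_sum_exp_mul_Iic_le hρpos hw hdeven hle x) hι.le
  have hS : sSup A ≤ 0 := by nlinarith
  intro τ hτ
  exact sub_eq_zero.mp (abs_nonpos_iff.mp ((hle τ hτ).trans hS))
end

section
/- Let H be a real p×p matrix, let m₁, ν ∈ ℝ, ρ > 0, and ε ∈ ℝ with ε ≠ 1. Define b : [0, ∞) → ℝ^p by b(u) = (m₁ u / ((1 − ε)(2 + ρu))) · (ζ(uH) + νρ u ω(uH)) · 𝟙, where 𝟙 = (1, …, 1)ᵀ. Then b(0) = 0 and b is differentiable with, for every u ≥ 0, b'(u) = (−H − (ρ/(2 + ρu)) I) · b(u) + (m₁/(1 − ε)) · ((1 + νρ u)/(2 + ρu)) · 𝟙. -/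
open Matrix
open scoped Nat

section TopologicalAlgebra

variable {A : Type*} [Ring A] [Algebra ℝ A] [TopologicalSpace A]

/-- The `k`-th term of the `n`-fold iterated primitive of `u ↦ exp (-u H)`. -/
noncomputable def primitiveTerm (H : A) (n k : ℕ) (u : ℝ) : A :=
  ((-1 : ℝ) ^ k * u ^ (k + n) / ((k + n)! : ℝ)) • H ^ k

/-- The `n`-fold iterated primitive of `u ↦ exp (-u H)`, vanishing at `0` when `0 < n`. -/
noncomputable def iteratedPrimitive (H : A) (n : ℕ) (u : ℝ) : A :=
  ∑' k : ℕ, primitiveTerm H n k u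

theorem iteratedPrimitive_eq_smul_tsum [T2Space A] [ContinuousConstSMul ℝ A]
    (H : A) (n : ℕ) (u : ℝ) :
    iteratedPrimitive H n u =
      u ^ n • ∑' k : ℕ, ((-1 : ℝ) ^ k / ((k + n)! : ℝ)) • (u • H) ^ k := by
  rw [iteratedPrimitive, ← tsum_const_smul'']
  refine tsum_congr fun k => ?_
  rw [primitiveTerm, smul_pow, smul_smul, smul_smul]
  congr 1
  ring

end TopologicalAlgebra

section BanachAlgebra

variable {A : Type*} [NormedRing A] [NormedAlgebra ℝ A]

theorem norm_primitiveTerm_le (H : A) (n k : ℕ) {u R : ℝ} (hu : |u| ≤ R) :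
    ‖primitiveTerm H n k u‖ ≤ R ^ n * ‖((k ! : ℝ)⁻¹) • (R • H) ^ k‖ := by
  have hR : 0 ≤ R := (abs_nonneg u).trans hu
  have hfac : ((k + n)! : ℝ)⁻¹ ≤ (k ! : ℝ)⁻¹ := by
    gcongr
    omega
  rw [primitiveTerm, smul_pow, norm_smul, norm_smul, norm_smul]
  simp only [norm_mul, norm_pow, norm_neg, norm_one, one_pow, one_mul, norm_inv,
    Real.norm_eq_abs, Nat.abs_cast, abs_of_nonneg hR, div_eq_mul_inv]
  calc |u| ^ (k + n) * ((k + n)! : ℝ)⁻¹ * ‖H ^ k‖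
      ≤ R ^ (k + n) * (k ! : ℝ)⁻¹ * ‖H ^ k‖ := by gcongr
    _ = R ^ n * ((k ! : ℝ)⁻¹ * (R ^ k * ‖H ^ k‖)) := by ring

theorem summable_primitiveTerm_bound (H : A) (n : ℕ) (R : ℝ) :
    Summable fun k : ℕ => R ^ n * ‖((k ! : ℝ)⁻¹) • (R • H) ^ k‖ :=
  (NormedSpace.norm_expSeries_summable' (𝕂 := ℝ) (R • H)).mul_left _

theorem hasDerivAt_primitiveTerm (H : A) (n k : ℕ) (u : ℝ) :
    HasDerivAt (primitiveTerm H (n + 1) k) (primitiveTerm H n k u) u := by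
  have h := ((((hasDerivAt_pow (k + n + 1) u).const_mul ((-1 : ℝ) ^ k)).div_const
    ((k + n + 1)! : ℝ)).smul_const (H ^ k))
  refine h.congr_deriv ?_
  rw [primitiveTerm, Nat.factorial_succ]
  congr 1
  push_cast
  have h₁ : ((k + n)! : ℝ) ≠ 0 := by positivity
  have h₂ : ((k : ℝ) + n + 1) ≠ 0 := by positivity
  field_simp

variable [CompleteSpace A]

theorem summable_primitiveTerm (H : A) (n : ℕ) (u : ℝ) :
    Summable fun k => primitiveTerm H n k u :=
  .of_norm_bounded (summable_primitiveTerm_bound H n |u|)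
    fun k => norm_primitiveTerm_le H n k le_rfl

theorem hasDerivAt_iteratedPrimitive (H : A) (n : ℕ) (u : ℝ) :
    HasDerivAt (iteratedPrimitive H (n + 1)) (iteratedPrimitive H n u) u := by
  have hmem : u ∈ Metric.ball (0 : ℝ) (|u| + 1) := by simp
  refine hasDerivAt_tsum_of_isPreconnected (summable_primitiveTerm_bound H n (|u| + 1))
    Metric.isOpen_ball (convex_ball (0 : ℝ) (|u| + 1)).isPreconnected
    (fun k y _ => hasDerivAt_primitiveTerm H n k y)
    (fun k y hy => norm_primitiveTerm_le H n k ?_) hmem (summable_primitiveTerm H (n + 1) u) hmem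
  simpa using (mem_ball_zero_iff.mp hy).le

theorem iteratedPrimitive_eq (H : A) (n : ℕ) (u : ℝ) :
    iteratedPrimitive H n u =
      (u ^ n / (n ! : ℝ)) • (1 : A) - H * iteratedPrimitive H (n + 1) u := by
  rw [iteratedPrimitive, (summable_primitiveTerm H n u).tsum_eq_zero_add, iteratedPrimitive,
    ← (summable_primitiveTerm H (n + 1) u).tsum_mul_left, sub_eq_add_neg, ← tsum_neg]
  congr 1
  · simp [primitiveTerm]
  · refine tsum_congr fun k => ?_
    rw [primitiveTerm, primitiveTerm, mul_smul_comm, ← pow_succ', ← neg_smul,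
      show k + 1 + n = k + (n + 1) by omega]
    congr 1
    ring

end BanachAlgebra

section Matrix

attribute [local instance] Matrix.linftyOpNormedRing Matrix.linftyOpNormedAlgebra

variable {p : Type*} [Fintype p] [DecidableEq p]

theorem hasDerivAt_iteratedPrimitive_mulVec (H : Matrix p p ℝ) (n : ℕ) (v : p → ℝ) (u : ℝ) :
    HasDerivAt (fun u => iteratedPrimitive H (n + 1) u *ᵥ v) (iteratedPrimitive H n u *ᵥ v) u :=
  let L : Matrix p p ℝ →ₗ[ℝ] p → ℝ := (Matrix.mulVecBilin ℝ ℝ).flip v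
  L.toContinuousLinearMap.hasFDerivAt.comp_hasDerivAt u (hasDerivAt_iteratedPrimitive H n u)

theorem iteratedPrimitive_mulVec (H : Matrix p p ℝ) (n : ℕ) (v : p → ℝ) (u : ℝ) :
    iteratedPrimitive H n u *ᵥ v =
      (u ^ n / (n ! : ℝ)) • v - H *ᵥ (iteratedPrimitive H (n + 1) u *ᵥ v) := by
  have h : iteratedPrimitive H n u =
      (u ^ n / (n ! : ℝ)) • (1 : Matrix p p ℝ) - H * iteratedPrimitive H (n + 1) u :=
    iteratedPrimitive_eq H n u
  rw [h, Matrix.sub_mulVec, Matrix.smul_mulVec, Matrix.one_mulVec, Matrix.mulVec_mulVec]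

end Matrix

/-- With `ζ(M) = ∑_{k≥0} (−1)^k M^k/(k+1)!`,
`ω(M) = ∑_{k≥0} (−1)^k M^k/(k+2)!` and `𝟙 = (1,…,1)ᵀ`, the function
`b(u) = (m₁ u / ((1−ε)(2+ρu))) (ζ(uH) + νρu ω(uH)) 𝟙` satisfies `b(0) = 0` and, for every
`u ≥ 0`, `b'(u) = (−H − (ρ/(2+ρu)) I) b(u) + (m₁/(1−ε)) ((1+νρu)/(2+ρu)) 𝟙`. -/
theorem stmt14 (p : ℕ) (H : Matrix (Fin p) (Fin p) ℝ) (m₁ ν ρ ε : ℝ)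
    (hρ : 0 < ρ) (hε : ε ≠ 1)
    (b : ℝ → Fin p → ℝ)
    (hb : b = fun u =>
      (m₁ * u / ((1 - ε) * (2 + ρ * u))) •
        (((∑' k : ℕ, ((-1 : ℝ) ^ k / (Nat.factorial (k + 1) : ℝ)) • (u • H) ^ k)
            + (ν * ρ * u) •
                (∑' k : ℕ, ((-1 : ℝ) ^ k / (Nat.factorial (k + 2) : ℝ)) • (u • H) ^ k))
          *ᵥ fun _ => (1 : ℝ))) :
    b 0 = 0 ∧
    ∀ u : ℝ, 0 ≤ u →
      HasDerivAt b
        (((-H - (ρ / (2 + ρ * u)) • (1 : Matrix (Fin p) (Fin p) ℝ)) *ᵥ b u)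
          + ((m₁ / (1 - ε)) * ((1 + ν * ρ * u) / (2 + ρ * u))) • fun _ => (1 : ℝ)) u := by
  have hε' : 1 - ε ≠ 0 := sub_ne_zero.mpr hε.symm
  set e : Fin p → ℝ := fun _ => 1
  set F : ℝ → Fin p → ℝ := fun u =>
    iteratedPrimitive H 1 u *ᵥ e + (ν * ρ) • (iteratedPrimitive H 2 u *ᵥ e) with hF
  have hbF : b = fun u => (m₁ / ((1 - ε) * (2 + ρ * u))) • F u := by
    rw [hb]
    funext u
    simp only [hF, iteratedPrimitive_eq_smul_tsum, Matrix.add_mulVec, Matrix.smul_mulVec]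
    module
  refine ⟨by simp [hb], fun u hu => ?_⟩
  have hden : 2 + ρ * u ≠ 0 := by positivity
  have hF' : HasDerivAt F ((1 + ν * ρ * u) • e - H *ᵥ F u) u := by
    refine ((hasDerivAt_iteratedPrimitive_mulVec H 0 e u).add
      ((hasDerivAt_iteratedPrimitive_mulVec H 1 e u).const_smul (ν * ρ))).congr_deriv ?_
    rw [iteratedPrimitive_mulVec H 0]
    simp only [hF, Matrix.mulVec_add, Matrix.mulVec_smul, zero_add]
    rw [iteratedPrimitive_mulVec H 1 e u]
    simp only [pow_zero, pow_one, Nat.factorial_zero, Nat.factorial_one, Nat.cast_one,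
      Nat.reduceAdd]
    module
  have hc : HasDerivAt (fun u => m₁ / ((1 - ε) * (2 + ρ * u)))
      (-(ρ / (2 + ρ * u)) * (m₁ / ((1 - ε) * (2 + ρ * u)))) u := by
    have hd : HasDerivAt (fun u => (1 - ε) * (2 + ρ * u)) ((1 - ε) * (ρ * 1)) u :=
      (((hasDerivAt_id u).const_mul ρ).const_add 2).const_mul (1 - ε)
    refine ((hasDerivAt_const u m₁).div hd (mul_ne_zero hε' hden)).congr_deriv ?_
    field_simp
    ring
  rw [hbF]
  refine (hc.smul hF').congr_deriv ?_
  simp only [Matrix.sub_mulVec, Matrix.neg_mulVec, Matrix.smul_mulVec, Matrix.one_mulVec,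
    Matrix.mulVec_smul]
  match_scalars <;> field_simp
end
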